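/- For all δ>0 there exists Δ₀=Δ₀(δ) such that for every finite graph G=(V,E) with maximum degree Δ≥Δ₀ and girth at least 6, every 0<λ<(1−δ)·λ_c(Δ), and every v∈V: | ( (λ/(1+λ))·E_{X∼μ}[R(X,v)] ) / μ(v is occupied) − 1 | ≤ 200·e^e·λ, where μ is the hard-core Gibbs distribution and the expectation is over X distributed according to μ. -/

import Mathlib

open scoped BigOperators

attribute [local instance] Classical.propDecidable

noncomputable section

namespace HardCore

/-- The critical fugacity `λ_c(Δ) = (Δ-1)^(Δ-1) / (Δ-2)^Δ`. -/
def lambdaC (D : ℕ) : ℝ := ((D : ℝ) - 1) ^ (D - 1) / ((D : ℝ) - 2) ^ D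

variable {V : Type} [Fintype V] [DecidableEq V]

/-- `s` is an independent set of `G`. -/
def IsIndep (G : SimpleGraph V) (s : Finset V) : Prop :=
  ∀ u ∈ s, ∀ w ∈ s, ¬ G.Adj u w

/-- hard-core weight `λ^|σ|` of an independent set (0 for non-independent sets). -/
def weight (G : SimpleGraph V) (lam : ℝ) (s : Finset V) : ℝ :=
  if IsIndep G s then lam ^ s.card else 0

/-- The hard-core Gibbs distribution `μ(σ) = λ^|σ| / Z`. -/
def gibbs (G : SimpleGraph V) (lam : ℝ) (s : Finset V) : ℝ :=
  weight G lam s / ∑ t : Finset V, weight G lam t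

/-- Probability of an event under the Gibbs distribution. -/
def gibbsProb (G : SimpleGraph V) (lam : ℝ) (A : Set (Finset V)) : ℝ :=
  ∑ s : Finset V, if s ∈ A then gibbs G lam s else 0

/-- Expectation of a function under the Gibbs distribution. -/
def gibbsExp (G : SimpleGraph V) (lam : ℝ) (f : Finset V → ℝ) : ℝ :=
  ∑ s : Finset V, gibbs G lam s * f s

/-- `U_{v,p}(σ)`: indicator that `σ ∩ (N(v) \ {p}) = ∅`. -/
def unblockedInd (G : SimpleGraph V) [DecidableRel G.Adj] (σ : Finset V) (v p : V) : ℝ :=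
  if σ ∩ ((G.neighborFinset v).erase p) = ∅ then 1 else 0

/-- `R(σ,v) = ∏_{z ∈ N(v)} (1 - (λ/(1+λ))·U_{z,v}(σ))`. -/
def Rfun (G : SimpleGraph V) [DecidableRel G.Adj] (lam : ℝ) (σ : Finset V) (v : V) : ℝ :=
  ∏ z ∈ G.neighborFinset v, (1 - lam / (1 + lam) * unblockedInd G σ z v)

/-- A graph without cycles of length less than six has no triangles. -/
theorem not_adj_of_six_le_egirth {W : Type} {G : SimpleGraph W} (hG : 6 ≤ G.egirth) {u w x : W}
    (huw : G.Adj u w) (hux : G.Adj u x) : ¬ G.Adj w x := by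
  intro hwx
  have h3 : G.IsNClique 3 {u, w, x} := SimpleGraph.is3Clique_triple_iff.2 ⟨huw, hux, hwx⟩
  obtain ⟨a, p, hp, hlen⟩ := SimpleGraph.is3Clique_iff_exists_cycle_length_three.1 ⟨_, h3⟩
  have := SimpleGraph.le_egirth.1 hG a p hp
  rw [hlen] at this
  have h63 : (6 : ℕ) ≤ 3 := by exact_mod_cast this
  omega

theorem weight_nonneg {W : Type} (G : SimpleGraph W) {lam : ℝ} (hlam : 0 < lam) (s : Finset W) :
    0 ≤ weight G lam s := by
  unfold weight
  split_ifs <;> positivity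

theorem Rfun_nonneg (G : SimpleGraph V) [DecidableRel G.Adj] {lam : ℝ} (hlam : 0 < lam)
    (s : Finset V) (v : V) : 0 ≤ Rfun G lam s v := by
  refine Finset.prod_nonneg fun z _ => ?_
  have : lam / (1 + lam) ≤ 1 := (div_le_one (by positivity)).2 (by linarith)
  unfold unblockedInd
  split_ifs <;> linarith

theorem Rfun_le_one (G : SimpleGraph V) [DecidableRel G.Adj] {lam : ℝ} (hlam : 0 < lam)
    (s : Finset V) (v : V) : Rfun G lam s v ≤ 1 := by
  have h0 : 0 ≤ lam / (1 + lam) := by positivity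
  have h1 : lam / (1 + lam) ≤ 1 := (div_le_one (by positivity)).2 (by linarith)
  refine Finset.prod_le_one (fun z _ => ?_) fun z _ => ?_ <;> unfold unblockedInd <;>
    split_ifs <;> linarith

/-- In a triangle-free graph `R(σ,v)` does not depend on `σ ∩ N(v)`. -/
theorem Rfun_sdiff_neighborFinset {G : SimpleGraph V} [DecidableRel G.Adj]
    (hG : 6 ≤ G.egirth) (lam : ℝ) (s : Finset V) (v : V) :
    Rfun G lam (s \ G.neighborFinset v) v = Rfun G lam s v := by
  refine Finset.prod_congr rfl fun z hz => ?_
  have hz' : G.Adj v z := (G.mem_neighborFinset v z).1 hz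
  have : (s \ G.neighborFinset v) ∩ (G.neighborFinset z).erase v
      = s ∩ (G.neighborFinset z).erase v := by
    ext w
    simp only [Finset.mem_inter, Finset.mem_sdiff, Finset.mem_erase, SimpleGraph.mem_neighborFinset]
    constructor
    · tauto
    · rintro ⟨hs, hwv, hzw⟩
      exact ⟨⟨hs, fun h => not_adj_of_six_le_egirth hG hz' h hzw⟩, hwv, hzw⟩
  simp only [unblockedInd, this]

/-- The neighbours of `v` that have no neighbour in `t`, apart from possibly `v`. -/
def freeNeighbors (G : SimpleGraph V) [DecidableRel G.Adj] (t : Finset V) (v : V) : Finset V :=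
  (G.neighborFinset v).filter fun z => t ∩ (G.neighborFinset z).erase v = ∅

theorem Rfun_eq_pow (G : SimpleGraph V) [DecidableRel G.Adj] {lam : ℝ} (hlam : 0 < lam)
    (t : Finset V) (v : V) :
    Rfun G lam t v = ((1 + lam)⁻¹) ^ (freeNeighbors G t v).card := by
  have h1 : (1 : ℝ) + lam ≠ 0 := by positivity
  rw [freeNeighbors, ← Finset.prod_const, Finset.prod_filter]
  refine Finset.prod_congr rfl fun z _ => ?_
  unfold unblockedInd
  split_ifs
  · field_simp
    ring
  · simp

/-- The independent sets avoiding `v` and all its neighbours. -/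
def indepAway (G : SimpleGraph V) [DecidableRel G.Adj] (v : V) : Finset (Finset V) :=
  Finset.univ.filter fun t => IsIndep G t ∧ v ∉ t ∧ ∀ z ∈ t, ¬ G.Adj v z

/-- In a triangle-free graph, the independent sets avoiding `v` whose part outside `N(v)` is `t`
correspond to the subsets of the free neighbours of `v`. -/
theorem sum_fiber_eq {G : SimpleGraph V} [DecidableRel G.Adj] (hG : 6 ≤ G.egirth) (lam : ℝ)
    {v : V} {t : Finset V} (ht : t ∈ indepAway G v) :
    ∑ s ∈ Finset.univ.filter (fun s => (IsIndep G s ∧ v ∉ s) ∧ s \ G.neighborFinset v = t),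
      lam ^ s.card = lam ^ t.card * (1 + lam) ^ (freeNeighbors G t v).card := by
  obtain ⟨hti, hvt, hta⟩ := (Finset.mem_filter.1 ht).2
  have hF : ∀ z, z ∈ freeNeighbors G t v ↔ G.Adj v z ∧ ∀ w ∈ t, ¬ G.Adj z w := by
    intro z
    simp only [freeNeighbors, Finset.mem_filter, SimpleGraph.mem_neighborFinset,
      Finset.eq_empty_iff_forall_notMem, Finset.mem_inter, Finset.mem_erase]
    refine and_congr_right fun _ => forall_congr' fun w => ?_
    constructor
    · exact fun h hw hzw => h ⟨hw, fun e => hvt (e ▸ hw), hzw⟩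
    · exact fun h hw => h hw.1 hw.2.2
  have hdisj : ∀ b ⊆ freeNeighbors G t v, Disjoint t b := fun b hb =>
    Finset.disjoint_left.2 fun z hz hzb => hta z hz ((hF z).1 (hb hzb)).1
  have hpow : (1 + lam) ^ (freeNeighbors G t v).card
      = ∑ b ∈ (freeNeighbors G t v).powerset, lam ^ b.card := by
    have := Finset.sum_pow_mul_eq_add_pow lam 1 (freeNeighbors G t v)
    simp only [one_pow, mul_one] at this
    rw [this, add_comm]
  rw [hpow, Finset.mul_sum]
  refine Finset.sum_nbij' (fun s => s ∩ G.neighborFinset v) (fun b => t ∪ b) ?_ ?_ ?_ ?_ ?_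
  · intro s hs
    obtain ⟨⟨hsi, hvs⟩, hst⟩ := (Finset.mem_filter.1 hs).2
    rw [Finset.mem_powerset]
    intro z hz
    rw [Finset.mem_inter, SimpleGraph.mem_neighborFinset] at hz
    refine (hF z).2 ⟨hz.2, fun w hw => hsi z hz.1 w ?_⟩
    rw [← hst] at hw
    exact (Finset.mem_sdiff.1 hw).1
  · intro b hb
    rw [Finset.mem_powerset] at hb
    refine Finset.mem_filter.2 ⟨Finset.mem_univ _, ⟨?_, ?_⟩, ?_⟩
    · intro x hx y hy hxy
      rcases Finset.mem_union.1 hx with hx | hx <;> rcases Finset.mem_union.1 hy with hy | hy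
      · exact hti x hx y hy hxy
      · exact ((hF y).1 (hb hy)).2 x hx hxy.symm
      · exact ((hF x).1 (hb hx)).2 y hy hxy
      · exact not_adj_of_six_le_egirth hG ((hF x).1 (hb hx)).1 ((hF y).1 (hb hy)).1 hxy
    · intro hv
      rcases Finset.mem_union.1 hv with hv | hv
      · exact hvt hv
      · exact G.loopless.irrefl v ((hF v).1 (hb hv)).1
    · ext z
      simp only [Finset.mem_sdiff, Finset.mem_union, SimpleGraph.mem_neighborFinset]
      constructor
      · rintro ⟨hz | hz, hn⟩
        · exact hz
        · exact absurd ((hF z).1 (hb hz)).1 hn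
      · exact fun hz => ⟨Or.inl hz, hta z hz⟩
  · intro s hs
    obtain ⟨-, hst⟩ := (Finset.mem_filter.1 hs).2
    simp only [← hst, Finset.sdiff_union_inter]
  · intro b hb
    rw [Finset.mem_powerset] at hb
    ext z
    simp only [Finset.mem_inter, Finset.mem_union, SimpleGraph.mem_neighborFinset]
    constructor
    · rintro ⟨hz | hz, hn⟩
      · exact absurd hn (hta z hz)
      · exact hz
    · exact fun hz => ⟨Or.inr hz, ((hF z).1 (hb hz)).1⟩
  · intro s hs
    obtain ⟨-, hst⟩ := (Finset.mem_filter.1 hs).2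
    rw [← pow_add, ← hst, Finset.card_sdiff_add_card_inter]

/-- The `R`-weighted partition function of the sets avoiding `v` is the partition function of the
sets avoiding `v` and its neighbours. -/
theorem sum_weight_mul_Rfun_of_notMem {G : SimpleGraph V} [DecidableRel G.Adj]
    (hG : 6 ≤ G.egirth) {lam : ℝ} (hlam : 0 < lam) (v : V) :
    (∑ s : Finset V, if v ∈ s then 0 else weight G lam s * Rfun G lam s v)
      = ∑ t ∈ indepAway G v, lam ^ t.card := by
  have h1 : (∑ s : Finset V, if v ∈ s then 0 else weight G lam s * Rfun G lam s v)
      = ∑ s ∈ Finset.univ.filter (fun s => IsIndep G s ∧ v ∉ s),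
          lam ^ s.card * Rfun G lam s v := by
    rw [Finset.sum_filter]
    refine Finset.sum_congr rfl fun s _ => ?_
    by_cases hv : v ∈ s <;> by_cases hs : IsIndep G s <;> simp [weight, hv, hs]
  rw [h1, ← Finset.sum_fiberwise_of_maps_to (t := indepAway G v)
    (g := fun s => s \ G.neighborFinset v)]
  · refine Finset.sum_congr rfl fun t ht => ?_
    rw [Finset.filter_filter]
    have : ∀ s ∈ Finset.univ.filter
        (fun s => (IsIndep G s ∧ v ∉ s) ∧ s \ G.neighborFinset v = t),
        lam ^ s.card * Rfun G lam s v = lam ^ s.card * Rfun G lam t v := by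
      intro s hs
      rw [← (Finset.mem_filter.1 hs).2.2, Rfun_sdiff_neighborFinset hG]
    rw [Finset.sum_congr rfl this, ← Finset.sum_mul, sum_fiber_eq hG lam ht, Rfun_eq_pow G hlam,
      mul_assoc, ← mul_pow, mul_inv_cancel₀ (by positivity), one_pow, mul_one]
  · intro s hs
    obtain ⟨hsi, hvs⟩ := (Finset.mem_filter.1 hs).2
    refine Finset.mem_filter.2 ⟨Finset.mem_univ _, fun x hx y hy => ?_, fun h => ?_, fun z hz => ?_⟩
    · exact hsi x (Finset.mem_sdiff.1 hx).1 y (Finset.mem_sdiff.1 hy).1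
    · exact hvs (Finset.mem_sdiff.1 h).1
    · simpa using (Finset.mem_sdiff.1 hz).2

/-- Removing `v` from the independent sets containing it. -/
theorem sum_weight_of_mem (G : SimpleGraph V) [DecidableRel G.Adj] (lam : ℝ) (v : V) :
    (∑ s : Finset V, if v ∈ s then weight G lam s else 0)
      = lam * ∑ t ∈ indepAway G v, lam ^ t.card := by
  have h1 : (∑ s : Finset V, if v ∈ s then weight G lam s else 0)
      = ∑ s ∈ Finset.univ.filter (fun s => IsIndep G s ∧ v ∈ s), lam ^ s.card := by
    rw [Finset.sum_filter]
    refine Finset.sum_congr rfl fun s _ => ?_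
    by_cases hv : v ∈ s <;> by_cases hs : IsIndep G s <;> simp [weight, hv, hs]
  rw [h1, Finset.mul_sum]
  refine Finset.sum_nbij' (fun s => s.erase v) (fun t => insert v t) ?_ ?_ ?_ ?_ ?_
  · intro s hs
    obtain ⟨hsi, hvs⟩ := (Finset.mem_filter.1 hs).2
    refine Finset.mem_filter.2 ⟨Finset.mem_univ _, fun x hx y hy => ?_, ?_, fun z hz => ?_⟩
    · exact hsi x (Finset.mem_of_mem_erase hx) y (Finset.mem_of_mem_erase hy)
    · exact Finset.notMem_erase v s
    · exact hsi v hvs z (Finset.mem_of_mem_erase hz)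
  · intro t ht
    obtain ⟨hti, hvt, hta⟩ := (Finset.mem_filter.1 ht).2
    refine Finset.mem_filter.2 ⟨Finset.mem_univ _, fun x hx y hy hxy => ?_,
      Finset.mem_insert_self v t⟩
    rcases Finset.mem_insert.1 hx with hxv | hxt <;>
      rcases Finset.mem_insert.1 hy with hyv | hyt
    · exact hxy.ne (hxv.trans hyv.symm)
    · exact hta y hyt (hxv ▸ hxy)
    · exact hta x hxt (hyv ▸ hxy.symm)
    · exact hti x hxt y hyt hxy
  · intro s hs
    exact Finset.insert_erase (Finset.mem_filter.1 hs).2.2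
  · intro t ht
    exact Finset.erase_insert (Finset.mem_filter.1 ht).2.2.1
  · intro s hs
    rw [← pow_succ', Finset.card_erase_add_one (Finset.mem_filter.1 hs).2.2]

/-- For every fugacity, the ratio of `λ/(1+λ) · E[R(X,v)]` and `μ(v is occupied)` differs from `1`
by at most `λ`. -/
theorem abs_ratio_sub_one_le {G : SimpleGraph V} [DecidableRel G.Adj] (hG : 6 ≤ G.egirth)
    {lam : ℝ} (hlam : 0 < lam) (v : V) :
    |(lam / (1 + lam) * gibbsExp G lam (fun σ => Rfun G lam σ v)) /
        gibbsProb G lam {σ : Finset V | v ∈ σ} - 1| ≤ lam := by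
  set Z : ℝ := ∑ t : Finset V, weight G lam t with hZ
  set Y : ℝ := ∑ t ∈ indepAway G v, lam ^ t.card with hY
  set E : ℝ := ∑ s : Finset V, if v ∈ s then weight G lam s * Rfun G lam s v else 0 with hE
  have hYpos : 0 < Y := by
    refine Finset.sum_pos (fun t _ => by positivity) ⟨∅, ?_⟩
    exact Finset.mem_filter.2 ⟨Finset.mem_univ _, by simp [IsIndep], by simp, by simp⟩
  have hE0 : 0 ≤ E := Finset.sum_nonneg fun s _ => by
    split_ifs
    · exact mul_nonneg (weight_nonneg G hlam s) (Rfun_nonneg G hlam s v)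
    · exact le_rfl
  have hE1 : E ≤ lam * Y := by
    rw [hY, ← sum_weight_of_mem]
    refine Finset.sum_le_sum fun s _ => ?_
    split_ifs
    · exact mul_le_of_le_one_right (weight_nonneg G hlam s) (Rfun_le_one G hlam s v)
    · exact le_rfl
  have hZpos : 0 < Z := by
    refine Finset.sum_pos' (fun s _ => weight_nonneg G hlam s) ⟨∅, Finset.mem_univ _, ?_⟩
    simp [weight, IsIndep]
  have hprob : gibbsProb G lam {σ : Finset V | v ∈ σ} = lam * Y / Z := by
    rw [hY, ← sum_weight_of_mem, Finset.sum_div]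
    refine Finset.sum_congr rfl fun s _ => ?_
    by_cases hv : v ∈ s <;> simp [gibbs, hv, hZ]
  have hexp : gibbsExp G lam (fun σ => Rfun G lam σ v) = (Y + E) / Z := by
    rw [hY, ← sum_weight_mul_Rfun_of_notMem hG hlam v, hE, ← Finset.sum_add_distrib,
      Finset.sum_div]
    refine Finset.sum_congr rfl fun s _ => ?_
    by_cases hv : v ∈ s <;> simp [gibbs, hv, hZ, div_mul_eq_mul_div]
  have hratio : lam / (1 + lam) * ((Y + E) / Z) / (lam * Y / Z) - 1
      = (E / Y - lam) / (1 + lam) := by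
    field_simp
    ring
  have hEY0 : 0 ≤ E / Y := by positivity
  have hEY1 : E / Y ≤ lam := (div_le_iff₀ hYpos).2 hE1
  rw [hexp, hprob, hratio, abs_div, abs_of_pos (by positivity : 0 < 1 + lam),
    div_le_iff₀ (by positivity), abs_le]
  constructor <;> nlinarith

end HardCore

open HardCore

theorem expectation_R_vs_occupation_probability :
    ∀ δ : ℝ, 0 < δ →
    ∃ Δ₀ : ℕ,
      ∀ (V : Type) [Fintype V] [DecidableEq V] (G : SimpleGraph V) [DecidableRel G.Adj]
        (Δ : ℕ) (lam : ℝ),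
        G.maxDegree = Δ → Δ₀ ≤ Δ → 6 ≤ G.egirth →
        0 < lam → lam < (1 - δ) * lambdaC Δ →
        ∀ v : V,
          |(lam / (1 + lam) * gibbsExp G lam (fun σ => Rfun G lam σ v)) /
              gibbsProb G lam {σ : Finset V | v ∈ σ} - 1|
            ≤ 200 * Real.exp (Real.exp 1) * lam := by
  intro δ _
  refine ⟨0, fun V _ _ G _ Δ lam _ _ hG hlam _ v => (abs_ratio_sub_one_le hG hlam v).trans ?_⟩
  have h1 : 1 ≤ Real.exp (Real.exp 1) := Real.one_le_exp (Real.exp_pos 1).le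
  nlinarith
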